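/- arXiv:1402.5634 — 4 statements merged into one kernel-verified Lean document; each statement's English description precedes it below -/
import Mathlib

section
/- Let d ≥ 1, let Σ be a symmetric positive definite d×d real matrix, let x, y ∈ ℝ^d and n ∈ ℕ. Then ∫_{ℝ^d} H(wᵀx) H(wᵀy) (wᵀx)^n (wᵀy)^n (2π)^{-d/2} det(Σ)^{-1/2} exp(−wᵀΣ⁻¹w/2) dw = ∫_{ℝ^d} H(uᵀa) H(uᵀb) (uᵀa)^n (uᵀb)^n (2π)^{-d/2} exp(−‖u‖²/2) du, where a = Σ^{1/2} x and b = Σ^{1/2} y and Σ^{1/2} is the unique symmetric positive definite square root of Σ. (Proposition 1: the covariance arc-cosine kernel K_{Σ,n}(x,y) equals the standard arc-cosine kernel K_n(Σ^{1/2}x, Σ^{1/2}y).) -/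
open MeasureTheory Matrix Real

/-- Heaviside step function: `H t = 1` if `t > 0`, else `0`. -/
noncomputable def Hs (t : ℝ) : ℝ := if 0 < t then 1 else 0

/-- Linear change of variables for Lebesgue integrals on `ι → ℝ`. -/
theorem integral_eq_integral_abs_det_mulVec {ι : Type*} [Fintype ι] [DecidableEq ι]
    (S : Matrix ι ι ℝ) (hS : IsUnit S) (f : (ι → ℝ) → ℝ) :
    ∫ w, f w = ∫ u, |S.det| * f (S *ᵥ u) := by
  have hbij : Function.Bijective S.mulVec :=
    ⟨mulVec_injective_iff_isUnit.2 hS, mulVec_surjective_iff_isUnit.2 hS⟩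
  have h := integral_image_eq_integral_abs_det_fderiv_smul volume MeasurableSet.univ
    (f' := fun _ => LinearMap.toContinuousLinearMap (Matrix.toLin' S))
    (fun u _ => (LinearMap.toContinuousLinearMap (Matrix.toLin' S)).hasFDerivAt.hasFDerivWithinAt)
    (hbij.injective.injOn (s := Set.univ)) f
  have himage : LinearMap.toContinuousLinearMap (Matrix.toLin' S) '' Set.univ = Set.univ := by
    rw [Set.image_univ]
    exact hbij.surjective.range_eq
  rw [himage] at h
  simpa using h

/-- A symmetric matrix can be moved across the dot product. -/
theorem mulVec_dotProduct_of_isSymm {ι : Type*} [Fintype ι] {S : Matrix ι ι ℝ}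
    (hS : S.IsSymm) (u v : ι → ℝ) : (S *ᵥ u) ⬝ᵥ v = u ⬝ᵥ (S *ᵥ v) := by
  rw [dotProduct_mulVec, ← mulVec_transpose, hS.eq]

/-- **Proposition 1.** The covariance arc-cosine kernel `K_{Σ,n}(x,y)` equals the standard
arc-cosine kernel `K_n(Σ^{1/2} x, Σ^{1/2} y)`, where `Σ^{1/2}` (here `S`) is the unique
symmetric positive definite square root of `Σ` (here `C`). Both sides are written as
Lebesgue integrals against the corresponding Gaussian densities. -/
theorem statement0 {d : ℕ} (hd : 1 ≤ d) (C S : Matrix (Fin d) (Fin d) ℝ)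
    (hC : C.PosDef) (hS : S.PosDef) (hSsymm : S.IsSymm) (hSS : S * S = C)
    (x y : Fin d → ℝ) (n : ℕ) :
    (∫ w : Fin d → ℝ,
        Hs (w ⬝ᵥ x) * Hs (w ⬝ᵥ y) * (w ⬝ᵥ x) ^ n * (w ⬝ᵥ y) ^ n *
          ((2 * π) ^ (-(d : ℝ) / 2) * C.det ^ (-(1 : ℝ) / 2) *
            Real.exp (-(w ⬝ᵥ (C⁻¹ *ᵥ w)) / 2))) =
    (∫ u : Fin d → ℝ,
        Hs (u ⬝ᵥ (S *ᵥ x)) * Hs (u ⬝ᵥ (S *ᵥ y)) *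
          (u ⬝ᵥ (S *ᵥ x)) ^ n * (u ⬝ᵥ (S *ᵥ y)) ^ n *
          ((2 * π) ^ (-(d : ℝ) / 2) * Real.exp (-(u ⬝ᵥ u) / 2))) := by
  have hdet : 0 < S.det := hS.det_pos
  have hunit : IsUnit S.det := hdet.ne'.isUnit
  have hCdet : C.det ^ (-(1 : ℝ) / 2) = S.det⁻¹ := by
    rw [← hSS, det_mul, ← sq, ← Real.rpow_natCast, ← Real.rpow_mul hdet.le,
      ← Real.rpow_neg_one]
    norm_num
  have hquad (u : Fin d → ℝ) : (S *ᵥ u) ⬝ᵥ (C⁻¹ *ᵥ (S *ᵥ u)) = u ⬝ᵥ u := by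
    rw [mulVec_dotProduct_of_isSymm hSsymm, ← hSS, Matrix.mul_inv_rev]
    simp only [mulVec_mulVec, ← Matrix.mul_assoc]
    rw [Matrix.mul_nonsing_inv S hunit, Matrix.one_mul, Matrix.nonsing_inv_mul S hunit,
      one_mulVec]
  rw [integral_eq_integral_abs_det_mulVec S hS.isUnit]
  congr 1 with u
  rw [hquad, hCdet, abs_of_pos hdet]
  simp only [mulVec_dotProduct_of_isSymm hSsymm]
  field_simp
end

section
/- Let (Z₁, Z₂) be a centered jointly Gaussian random vector in ℝ² with E[Z₁²] = E[Z₂²] = 1 and E[Z₁Z₂] = ρ for some ρ ∈ [−1, 1]. Then E[max(Z₁,0) · max(Z₂,0)] = (1/(2π)) ( √(1−ρ²) + (π − arccos ρ) ρ ). -/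
open MeasureTheory Matrix Real

/-- The standard Gaussian measure `N(0, I_d)` on `ℝ^d`, given by its density
`(2π)^{-d/2} exp(-‖w‖²/2)` w.r.t. Lebesgue measure. -/
noncomputable def stdGaussian (d : ℕ) : Measure (Fin d → ℝ) :=
  volume.withDensity fun w =>
    ENNReal.ofReal ((2 * π) ^ (-(d : ℝ) / 2) * Real.exp (-(w ⬝ᵥ w) / 2))

/-- The radial part of the second moment of a planar standard Gaussian. -/
theorem integral_Ioi_pow_three_mul_exp_neg_sq_div_two :
    ∫ r in Set.Ioi (0 : ℝ), r ^ 3 * Real.exp (-r ^ 2 / 2) = 2 := by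
  have h := integral_rpow_mul_exp_neg_mul_rpow (p := 2) (q := 3) (b := 1 / 2)
    (by norm_num) (by norm_num) (by norm_num)
  have hG : Real.Gamma 2 = 1 := Real.Gamma_two
  have hb : ((1 : ℝ) / 2) ^ (-(3 + 1) / 2 : ℝ) = 4 := by
    rw [show (-(3 + 1) / 2 : ℝ) = ((-2 : ℤ) : ℝ) by norm_num, Real.rpow_intCast]
    norm_num
  rw [hb, show ((3 : ℝ) + 1) / 2 = 2 by norm_num, hG] at h
  norm_num at h
  refine Eq.trans ?_ h
  refine setIntegral_congr_fun measurableSet_Ioi fun r _ => ?_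
  norm_cast
  ring_nf

/-- A unit vector of the plane has the form `(cos α, sin α)`. -/
theorem exists_cos_sin_of_sq_add_sq_eq_one {x y : ℝ} (h : x * x + y * y = 1) :
    ∃ α, x = Real.cos α ∧ y = Real.sin α := by
  have hn : ‖(⟨x, y⟩ : ℂ)‖ = 1 := by
    rw [Complex.norm_def, Complex.normSq_mk, h, Real.sqrt_one]
  have hz : (⟨x, y⟩ : ℂ) ≠ 0 := by
    intro h0
    rw [h0] at hn
    simp at hn
  exact ⟨Complex.arg ⟨x, y⟩, by rw [Complex.cos_arg hz, hn]; simp,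
    by rw [Complex.sin_arg, hn]; simp⟩

theorem integral_max_cos_mul_max_cos_sub {φ : ℝ} (h₀ : 0 ≤ φ) (hπ : φ ≤ π) :
    ∫ θ in -π..π, max (Real.cos θ) 0 * max (Real.cos (θ - φ)) 0 =
      (1 / 2) * (Real.sin φ + (π - φ) * Real.cos φ) := by
  have hpi := Real.pi_pos
  have hc : Continuous fun θ => max (Real.cos θ) 0 * max (Real.cos (θ - φ)) 0 := by fun_prop
  rw [← intervalIntegral.integral_add_adjacent_intervals (b := φ - π / 2)
    (hc.intervalIntegrable _ _) (hc.intervalIntegrable _ _),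
    ← intervalIntegral.integral_add_adjacent_intervals (a := φ - π / 2) (b := π / 2)
    (hc.intervalIntegrable _ _) (hc.intervalIntegrable _ _)]
  have hleft : ∫ θ in -π..(φ - π / 2), max (Real.cos θ) 0 * max (Real.cos (θ - φ)) 0 = 0 := by
    refine intervalIntegral.integral_zero_ae (.of_forall fun θ hθ => ?_)
    rw [Set.uIoc_of_le (by linarith)] at hθ
    by_cases h : θ ≤ -(π / 2)
    · have := Real.cos_nonpos_of_pi_div_two_le_of_le (x := -θ) (by linarith) (by linarith [hθ.1])
      rw [Real.cos_neg] at this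
      rw [max_eq_right this, zero_mul]
    · have := Real.cos_nonpos_of_pi_div_two_le_of_le (x := -(θ - φ)) (by linarith [hθ.2])
        (by linarith)
      rw [Real.cos_neg] at this
      rw [max_eq_right this, mul_zero]
  have hright : ∫ θ in (π / 2)..π, max (Real.cos θ) 0 * max (Real.cos (θ - φ)) 0 = 0 := by
    refine intervalIntegral.integral_zero_ae (.of_forall fun θ hθ => ?_)
    rw [Set.uIoc_of_le (by linarith)] at hθ
    have := Real.cos_nonpos_of_pi_div_two_le_of_le (x := θ) hθ.1.le (by linarith [hθ.2])
    rw [max_eq_right this, zero_mul]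
  have hmid : ∫ θ in (φ - π / 2)..(π / 2), max (Real.cos θ) 0 * max (Real.cos (θ - φ)) 0 =
      ∫ θ in (φ - π / 2)..(π / 2), (Real.cos φ / 2 + Real.cos (2 * θ - φ) / 2) := by
    refine intervalIntegral.integral_congr fun θ hθ => ?_
    rw [Set.uIcc_of_le (by linarith)] at hθ
    have h1 := Real.cos_nonneg_of_mem_Icc (x := θ) ⟨by linarith [hθ.1], hθ.2⟩
    have h2 := Real.cos_nonneg_of_mem_Icc (x := θ - φ)
      ⟨by linarith [hθ.1], by linarith [hθ.2]⟩
    simp only [max_eq_left h1, max_eq_left h2]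
    have e1 : Real.cos φ = Real.cos (θ - (θ - φ)) := by ring_nf
    have e2 : Real.cos (2 * θ - φ) = Real.cos (θ + (θ - φ)) := by ring_nf
    rw [e1, e2, Real.cos_sub θ (θ - φ), Real.cos_add θ (θ - φ)]
    ring
  have hval : ∫ θ in (φ - π / 2)..(π / 2), (Real.cos φ / 2 + Real.cos (2 * θ - φ) / 2) =
      (1 / 2) * (Real.sin φ + (π - φ) * Real.cos φ) := by
    have hd : ∀ θ ∈ Set.uIcc (φ - π / 2) (π / 2),
        HasDerivAt (fun θ => Real.cos φ / 2 * θ + Real.sin (2 * θ - φ) / 4)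
          (Real.cos φ / 2 + Real.cos (2 * θ - φ) / 2) θ := by
      intro θ _
      have h1 : HasDerivAt (fun θ : ℝ => 2 * θ - φ) 2 θ := by
        simpa using ((hasDerivAt_id θ).const_mul 2).sub_const φ
      have h2 := ((hasDerivAt_id θ).const_mul (Real.cos φ / 2)).add (h1.sin.div_const 4)
      convert! h2 using 1
      ring
    rw [intervalIntegral.integral_eq_sub_of_hasDerivAt hd
      (Continuous.intervalIntegrable (by fun_prop) _ _)]
    rw [show 2 * (π / 2) - φ = π - φ by ring, show 2 * (φ - π / 2) - φ = -(π - φ) by ring,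
      Real.sin_neg, Real.sin_pi_sub]
    ring
  rw [hleft, hright, hmid, hval]
  ring

theorem integral_max_cos_sub_mul_max_cos_sub (α β : ℝ) :
    ∫ θ in -π..π, max (Real.cos (θ - α)) 0 * max (Real.cos (θ - β)) 0 =
      (1 / 2) * (Real.sqrt (1 - Real.cos (α - β) ^ 2) +
        (π - Real.arccos (Real.cos (α - β))) * Real.cos (α - β)) := by
  set φ := Real.arccos (Real.cos (α - β)) with hφ
  have hcos : Real.cos φ = Real.cos (α - β) :=
    Real.cos_arccos (Real.neg_one_le_cos _) (Real.cos_le_one _)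
  rw [← Real.sin_arccos, ← hφ, ← hcos,
    ← integral_max_cos_mul_max_cos_sub (Real.arccos_nonneg _) (Real.arccos_le_pi _)]
  set f : ℝ → ℝ := fun θ => max (Real.cos θ) 0 * max (Real.cos (θ - (β - α))) 0 with hf
  have hper : Function.Periodic f (2 * π) := by
    intro θ
    simp only [hf]
    rw [Real.cos_add_two_pi, show θ + 2 * π - (β - α) = θ - (β - α) + 2 * π by ring,
      Real.cos_add_two_pi]
  have hshift : ∫ θ in -π..π, max (Real.cos (θ - α)) 0 * max (Real.cos (θ - β)) 0 =
      ∫ θ in -π..π, f θ := by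
    have h := intervalIntegral.integral_comp_sub_right (a := -π) (b := π) f α
    have hp := hper.intervalIntegral_add_eq (-π - α) (-π)
    rw [show -π - α + 2 * π = π - α by ring, show -π + 2 * π = π by ring] at hp
    rw [← hp, ← h]
    simp only [hf]
    congr! 5
    ring_nf
  rw [hshift]
  obtain ⟨k, hk | hk⟩ := (Real.cos_eq_cos_iff).1 hcos
  · rw [← neg_neg π, ← intervalIntegral.integral_comp_neg, neg_neg]
    refine intervalIntegral.integral_congr fun θ _ => ?_
    simp only [hf]
    rw [Real.cos_neg, show -θ - (β - α) = -(θ - φ) + k * (2 * π) by linarith,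
      Real.cos_add_int_mul_two_pi, Real.cos_neg]
  · refine intervalIntegral.integral_congr fun θ _ => ?_
    simp only [hf]
    rw [show θ - (β - α) = θ - φ + k * (2 * π) by linarith, Real.cos_add_int_mul_two_pi]

theorem stdGaussian_ne_zero (d : ℕ) : stdGaussian d ≠ 0 := by
  intro h
  rw [stdGaussian, withDensity_eq_zero_iff (by fun_prop)] at h
  have hF : ∀ᵐ _ : Fin d → ℝ, False := by
    filter_upwards [h] with w hw
    have : 0 < (2 * π) ^ (-(d : ℝ) / 2) * Real.exp (-(w ⬝ᵥ w) / 2) := by positivity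
    simp only [Pi.zero_apply, ENNReal.ofReal_eq_zero] at hw
    linarith
  rw [Filter.eventually_false_iff_eq_bot, ae_eq_bot] at hF
  exact NeZero.ne _ hF

theorem integral_stdGaussian_two (g : (Fin 2 → ℝ) → ℝ) :
    ∫ w, g w ∂stdGaussian 2 = (2 * π)⁻¹ *
      ∫ p in Set.Ioi (0 : ℝ) ×ˢ Set.Ioo (-π) π,
        p.1 * Real.exp (-p.1 ^ 2 / 2) * g ![p.1 * Real.cos p.2, p.1 * Real.sin p.2] := by
  rw [stdGaussian, integral_withDensity_eq_integral_toReal_smul (by fun_prop)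
    (.of_forall fun _ => ENNReal.ofReal_lt_top),
    ← (volume_preserving_finTwoArrow ℝ).symm.integral_comp
      (MeasurableEquiv.finTwoArrow.symm.measurableEmbedding), ← integral_comp_polarCoord_symm,
    polarCoord_target, ← integral_const_mul]
  refine setIntegral_congr_fun (measurableSet_Ioi.prod measurableSet_Ioo) fun p _ => ?_
  have hw : MeasurableEquiv.finTwoArrow.symm (polarCoord.symm p) =
      ![p.1 * Real.cos p.2, p.1 * Real.sin p.2] := by
    ext i; fin_cases i <;> rfl
  simp only [hw, smul_eq_mul]
  rw [ENNReal.toReal_ofReal (by positivity)]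
  have hdot : ![p.1 * Real.cos p.2, p.1 * Real.sin p.2] ⬝ᵥ
      ![p.1 * Real.cos p.2, p.1 * Real.sin p.2] = p.1 ^ 2 := by
    simp only [dotProduct, Fin.sum_univ_two, cons_val_zero, cons_val_one]
    linear_combination p.1 ^ 2 * Real.sin_sq_add_cos_sq p.2
  rw [hdot, show (-((2 : ℕ) : ℝ) / 2) = -1 by norm_num, Real.rpow_neg_one]
  ring

/-- For a centered jointly Gaussian vector `(Z₁, Z₂)` with unit variances and correlation `ρ`
(realized, as every such vector can be, as an affine image `A w` of a standard Gaussian `w`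
on `ℝ²` with `A Aᵀ = !![1, ρ; ρ, 1]`),
`E[(Z₁)₊ (Z₂)₊] = (1/(2π)) (√(1-ρ²) + (π - arccos ρ) ρ)`. -/
theorem statement2 (ρ : ℝ) (hρ : ρ ∈ Set.Icc (-1 : ℝ) 1)
    {Ω : Type*} [MeasurableSpace Ω] (μ : Measure Ω) [IsProbabilityMeasure μ]
    (Z : Ω → (Fin 2 → ℝ)) (A : Matrix (Fin 2) (Fin 2) ℝ)
    (hA : A * Aᵀ = !![1, ρ; ρ, 1])
    (hZ : Measure.map Z μ = Measure.map (fun w => A *ᵥ w) (stdGaussian 2)) :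
    ∫ ω, max (Z ω 0) 0 * max (Z ω 1) 0 ∂μ =
      (1 / (2 * π)) * (Real.sqrt (1 - ρ ^ 2) + (π - Real.arccos ρ) * ρ) := by
  have hmeas : Measurable fun w : Fin 2 → ℝ => A *ᵥ w := by fun_prop
  have hZm : AEMeasurable Z μ := by
    by_contra hn
    rw [Measure.map_of_not_aemeasurable hn, eq_comm,
      Measure.map_eq_zero_iff hmeas.aemeasurable] at hZ
    exact stdGaussian_ne_zero 2 hZ
  have h00 : A 0 0 * A 0 0 + A 0 1 * A 0 1 = 1 := by
    simpa [mul_apply, Fin.sum_univ_two] using congr_fun₂ hA 0 0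
  have h11 : A 1 0 * A 1 0 + A 1 1 * A 1 1 = 1 := by
    simpa [mul_apply, Fin.sum_univ_two] using congr_fun₂ hA 1 1
  have h01 : A 0 0 * A 1 0 + A 0 1 * A 1 1 = ρ := by
    simpa [mul_apply, Fin.sum_univ_two] using congr_fun₂ hA 0 1
  obtain ⟨α, hα, hα'⟩ := exists_cos_sin_of_sq_add_sq_eq_one h00
  obtain ⟨β, hβ, hβ'⟩ := exists_cos_sin_of_sq_add_sq_eq_one h11
  have hcos : Real.cos (α - β) = ρ := by rw [Real.cos_sub, ← hα, ← hα', ← hβ, ← hβ', h01]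
  have hG : Measurable fun z : Fin 2 → ℝ => max (z 0) 0 * max (z 1) 0 := by fun_prop
  rw [← integral_map hZm hG.aestronglyMeasurable, hZ,
    integral_map hmeas.aemeasurable hG.aestronglyMeasurable, integral_stdGaussian_two]
  have hpolar : ∫ p in Set.Ioi (0 : ℝ) ×ˢ Set.Ioo (-π) π, p.1 * Real.exp (-p.1 ^ 2 / 2) *
        (max ((A *ᵥ ![p.1 * Real.cos p.2, p.1 * Real.sin p.2]) 0) 0 *
          max ((A *ᵥ ![p.1 * Real.cos p.2, p.1 * Real.sin p.2]) 1) 0) =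
      ∫ p in Set.Ioi (0 : ℝ) ×ˢ Set.Ioo (-π) π, (p.1 ^ 3 * Real.exp (-p.1 ^ 2 / 2)) *
        (max (Real.cos (p.2 - α)) 0 * max (Real.cos (p.2 - β)) 0) := by
    refine setIntegral_congr_fun (measurableSet_Ioi.prod measurableSet_Ioo) fun p hp => ?_
    have hr : 0 ≤ p.1 := (Set.mem_Ioi.1 hp.1).le
    have e0 : (A *ᵥ ![p.1 * Real.cos p.2, p.1 * Real.sin p.2]) 0 =
        p.1 * Real.cos (p.2 - α) := by
      simp only [mulVec, dotProduct, Fin.sum_univ_two, cons_val_zero, cons_val_one, hα, hα',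
        Real.cos_sub]
      ring
    have e1 : (A *ᵥ ![p.1 * Real.cos p.2, p.1 * Real.sin p.2]) 1 =
        p.1 * Real.cos (p.2 - β) := by
      simp only [mulVec, dotProduct, Fin.sum_univ_two, cons_val_zero, cons_val_one, hβ, hβ',
        Real.cos_sub]
      ring
    have hmax : ∀ x : ℝ, max (p.1 * x) 0 = p.1 * max x 0 := fun x => by
      rw [mul_max_of_nonneg _ _ hr, mul_zero]
    simp only [e0, e1, hmax]
    ring
  rw [hpolar, Measure.volume_eq_prod,
    setIntegral_prod_mul (fun r : ℝ => r ^ 3 * Real.exp (-r ^ 2 / 2))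
    (fun θ : ℝ => max (Real.cos (θ - α)) 0 * max (Real.cos (θ - β)) 0),
    integral_Ioi_pow_three_mul_exp_neg_sq_div_two, ← integral_Ioc_eq_integral_Ioo,
    ← intervalIntegral.integral_of_le (by linarith [Real.pi_pos]),
    integral_max_cos_sub_mul_max_cos_sub, hcos]
  ring
end

section
/- Let d ≥ 1 and let x, y ∈ ℝ^d be nonzero vectors. If w is a random vector distributed as the standard Gaussian N(0, I_d) on ℝ^d, then P( wᵀx > 0 and wᵀy > 0 ) = (π − θ)/(2π), where θ = arccos( ⟨x,y⟩ / (‖x‖‖y‖) ) is the angle between x and y. (Closed form of the arc-cosine kernel of degree n = 0, i.e., for threshold hidden units.) -/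
open MeasureTheory Matrix Real

section

open ProbabilityTheory Set

/-- The standard Gaussian measure given by its density is the product of one-dimensional ones. -/
lemma stdGaussian_eq_pi (d : ℕ) :
    _root_.stdGaussian d = Measure.pi fun _ : Fin d => gaussianReal 0 1 := by
  have hdens (w : Fin d → ℝ) :
      (2 * π) ^ (-(d : ℝ) / 2) * Real.exp (-(w ⬝ᵥ w) / 2) = ∏ i, gaussianPDFReal 0 1 (w i) := by
    simp only [gaussianPDFReal, NNReal.coe_one, mul_one, sub_zero, Finset.prod_mul_distrib,
      Finset.prod_const, Finset.card_univ, Fintype.card_fin, ← Real.exp_sum]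
    congr 1
    · rw [Real.sqrt_eq_rpow, ← Real.rpow_neg (by positivity), ← Real.rpow_natCast,
        ← Real.rpow_mul (by positivity)]
      congr 1
      ring
    · simp only [dotProduct, ← Finset.sum_div, Finset.sum_neg_distrib, sq]
  refine (Measure.pi_eq fun s hs => ?_).symm
  rw [_root_.stdGaussian, withDensity_apply _ (MeasurableSet.univ_pi hs)]
  simp_rw [hdens]
  rw [volume_pi, Measure.restrict_pi_pi, ← ofReal_integral_eq_lintegral_ofReal,
    integral_fintype_prod_eq_prod (fun _ => gaussianPDFReal 0 1),
    ENNReal.ofReal_prod_of_nonneg]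
  · refine Finset.prod_congr rfl fun i _ => ?_
    rw [gaussianReal_apply_eq_integral 0 one_ne_zero]
  · exact fun i _ => integral_nonneg fun _ => gaussianPDFReal_nonneg _ _ _
  · exact Integrable.fintype_prod fun i => (integrable_gaussianPDFReal 0 1).restrict
  · exact ae_of_all _ fun w => Finset.prod_nonneg fun i _ => gaussianPDFReal_nonneg _ _ _

lemma charFunDual_gaussianReal_zero_one (L : StrongDual ℝ ℝ) :
    charFunDual (gaussianReal 0 1) L = Complex.exp (-((L 1 : ℝ) : ℂ) ^ 2 / 2) := by
  have h := charFun_gaussianReal (μ := 0) (v := 1) (L 1)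
  rw [charFun_apply_real] at h
  have hL (v : ℝ) : Complex.exp (L v * Complex.I) = Complex.exp ((L 1 : ℝ) * v * Complex.I) := by
    have hv := L.map_smul v 1
    rw [smul_eq_mul, mul_one, smul_eq_mul, mul_comm] at hv
    rw [hv, Complex.ofReal_mul]
  rw [charFunDual_apply, integral_congr_ae (ae_of_all _ hL), h]
  congr 1
  simp [neg_div]

/-- The planar standard Gaussian measure in polar coordinates, on a set depending only on the
angular coordinate. -/
lemma gaussianReal_prod_apply_eq_mul {S : Set (ℝ × ℝ)} {A : Set ℝ} (hS : MeasurableSet S)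
    (hA : MeasurableSet A)
    (hSA : ∀ r φ, 0 < r → φ ∈ Ioo (-π) π → ((r * cos φ, r * sin φ) ∈ S ↔ φ ∈ A)) :
    (gaussianReal 0 1).prod (gaussianReal 0 1) S =
      (∫⁻ r in Ioi (0 : ℝ), ENNReal.ofReal r * ENNReal.ofReal ((2 * π)⁻¹ * exp (-r ^ 2 / 2))) *
        volume (A ∩ Ioo (-π) π) := by
  have hdens (r φ : ℝ) : gaussianPDF 0 1 (r * cos φ) * gaussianPDF 0 1 (r * sin φ) =
      ENNReal.ofReal ((2 * π)⁻¹ * exp (-r ^ 2 / 2)) := by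
    rw [gaussianPDF, gaussianPDF, ← ENNReal.ofReal_mul (gaussianPDFReal_nonneg _ _ _)]
    simp only [gaussianPDFReal, NNReal.coe_one, mul_one, sub_zero]
    rw [mul_mul_mul_comm, ← Real.exp_add, ← mul_inv, Real.mul_self_sqrt (by positivity)]
    congr 3
    linear_combination (-r ^ 2 / 2) * sin_sq_add_cos_sq φ
  rw [gaussianReal_of_var_ne_zero 0 one_ne_zero,
    prod_withDensity (measurable_gaussianPDF _ _) (measurable_gaussianPDF _ _),
    withDensity_apply _ hS, ← lintegral_indicator hS, ← Measure.volume_eq_prod,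
    ← lintegral_comp_polarCoord_symm]
  calc
    _ = ∫⁻ p in Ioi (0 : ℝ) ×ˢ Ioo (-π) π,
        (ENNReal.ofReal p.1 * ENNReal.ofReal ((2 * π)⁻¹ * exp (-p.1 ^ 2 / 2))) *
          A.indicator 1 p.2 := by
      refine setLIntegral_congr_fun (measurableSet_Ioi.prod measurableSet_Ioo) ?_
      rintro ⟨r, φ⟩ ⟨hr, hφ⟩
      have h := hSA r φ hr hφ
      simp only [polarCoord_symm_apply, smul_eq_mul]
      by_cases hmem : φ ∈ A
      · rw [indicator_of_mem (h.2 hmem), indicator_of_mem hmem, hdens, Pi.one_apply, mul_one]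
      · rw [indicator_of_notMem (fun h' => hmem (h.1 h')), indicator_of_notMem hmem]
        simp
    _ = _ := by
      rw [Measure.volume_eq_prod, ← Measure.prod_restrict,
        lintegral_prod_mul
          (f := fun r => ENNReal.ofReal r * ENNReal.ofReal ((2 * π)⁻¹ * exp (-r ^ 2 / 2)))
          (by fun_prop) (measurable_one.indicator hA).aemeasurable,
        lintegral_indicator_one hA, Measure.restrict_apply hA]

lemma gaussianReal_prod_apply_eq_div {S : Set (ℝ × ℝ)} {A : Set ℝ} (hS : MeasurableSet S)
    (hA : MeasurableSet A)
    (hSA : ∀ r φ, 0 < r → φ ∈ Ioo (-π) π → ((r * cos φ, r * sin φ) ∈ S ↔ φ ∈ A)) :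
    (gaussianReal 0 1).prod (gaussianReal 0 1) S =
      volume (A ∩ Ioo (-π) π) / ENNReal.ofReal (2 * π) := by
  have huniv := gaussianReal_prod_apply_eq_mul (S := univ) (A := univ) .univ .univ (by simp)
  rw [measure_univ, univ_inter, Real.volume_Ioo, sub_neg_eq_add, ← two_mul] at huniv
  rw [gaussianReal_prod_apply_eq_mul hS hA hSA, ENNReal.eq_inv_of_mul_eq_one_left huniv.symm,
    mul_comm, div_eq_mul_inv]

/-- The law of a pair of linear functionals under the standard Gaussian measure depends only on
their Gram matrix. -/
lemma map_pi_gaussianReal_eq_map_prod {ι : Type*} [Fintype ι] (T : (ι → ℝ) →L[ℝ] ℝ × ℝ)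
    {x y : ι → ℝ} (hT : ∀ w, T w = (w ⬝ᵥ x, w ⬝ᵥ y)) {a b c : ℝ} (S : ℝ × ℝ →L[ℝ] ℝ × ℝ)
    (hS : ∀ p, S p = (a * p.1, b * p.1 + c * p.2))
    (hxx : x ⬝ᵥ x = a ^ 2) (hxy : x ⬝ᵥ y = a * b) (hyy : y ⬝ᵥ y = b ^ 2 + c ^ 2) :
    (Measure.pi fun _ : ι => gaussianReal 0 1).map T =
      ((gaussianReal 0 1).prod (gaussianReal 0 1)).map S := by
  classical
  refine Measure.ext_of_charFunDual (funext fun L => ?_)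
  have hL (u v : ℝ) : L (u, v) = u * L (1, 0) + v * L (0, 1) := by
    have h : ((u, v) : ℝ × ℝ) = u • (1, 0) + v • (0, 1) := by simp
    rw [h, map_add, map_smul, map_smul, smul_eq_mul, smul_eq_mul]
  rw [charFunDual_map, charFunDual_map, charFunDual_pi, charFunDual_prod]
  simp only [charFunDual_gaussianReal_zero_one, ← Complex.exp_sum, ← Complex.exp_add,
    ContinuousLinearMap.comp_apply, ContinuousLinearMap.single_apply,
    ContinuousLinearMap.inl_apply, ContinuousLinearMap.inr_apply, hT, hS, single_dotProduct,
    one_mul]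
  congr 1
  norm_cast
  simp only [hL (x _), hL a, hL 0 c, mul_zero, mul_one, zero_add, add_zero, zero_mul]
  have hsum : ∑ i, -(x i * L (1, 0) + y i * L (0, 1)) ^ 2 / 2 =
      -(L (1, 0) ^ 2 * x ⬝ᵥ x + 2 * L (1, 0) * L (0, 1) * x ⬝ᵥ y + L (0, 1) ^ 2 * y ⬝ᵥ y) / 2 := by
    simp only [dotProduct, Finset.mul_sum, ← Finset.sum_add_distrib, ← Finset.sum_neg_distrib,
      Finset.sum_div]
    exact Finset.sum_congr rfl fun i _ => by ring
  rw [hsum, hxx, hxy, hyy]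
  ring

lemma cos_pos_and_cos_sub_pos_iff {θ φ : ℝ} (hθ : θ ∈ Icc 0 π) (hφ : φ ∈ Ioo (-π) π) :
    0 < cos φ ∧ 0 < cos (φ - θ) ↔ φ ∈ Ioo (θ - π / 2) (π / 2) := by
  obtain ⟨hθ0, hθπ⟩ := hθ
  obtain ⟨hφ1, hφ2⟩ := hφ
  have hpi := pi_pos
  constructor
  · rintro ⟨h1, h2⟩
    have hlt : φ < π / 2 := by
      by_contra! h
      linarith [cos_nonpos_of_pi_div_two_le_of_le h (by linarith)]
    have hgt : -(π / 2) < φ := by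
      by_contra! h
      have := cos_nonpos_of_pi_div_two_le_of_le (x := -φ) (by linarith) (by linarith)
      rw [cos_neg] at this
      linarith
    refine ⟨?_, hlt⟩
    by_contra! h
    have := cos_nonpos_of_pi_div_two_le_of_le (x := -(φ - θ)) (by linarith) (by linarith)
    rw [cos_neg] at this
    linarith
  · rintro ⟨h1, h2⟩
    exact ⟨cos_pos_of_mem_Ioo ⟨by linarith, h2⟩, cos_pos_of_mem_Ioo ⟨by linarith, by linarith⟩⟩

end

/-- **Closed form of the degree-0 arc-cosine kernel (threshold units).**
For nonzero `x, y ∈ ℝ^d` and `w ∼ N(0, I_d)`,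
`P(wᵀx > 0 and wᵀy > 0) = (π - θ)/(2π)` where `θ = arccos(⟨x,y⟩/(‖x‖‖y‖))`. -/
theorem statement4 {d : ℕ} (hd : 1 ≤ d) (x y : Fin d → ℝ) (hx : x ≠ 0) (hy : y ≠ 0) :
    stdGaussian d {w | 0 < w ⬝ᵥ x ∧ 0 < w ⬝ᵥ y} =
      ENNReal.ofReal
        ((π - Real.arccos ((x ⬝ᵥ y) / (Real.sqrt (x ⬝ᵥ x) * Real.sqrt (y ⬝ᵥ y)))) /
          (2 * π)) := by
  have hpos {z : Fin d → ℝ} (hz : z ≠ 0) : 0 < z ⬝ᵥ z :=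
    (Finset.sum_nonneg fun i _ => mul_self_nonneg (z i)).lt_of_ne' (mt dotProduct_self_eq_zero.1 hz)
  set n := √(x ⬝ᵥ x)
  set m := √(y ⬝ᵥ y)
  have hn0 : 0 < n := Real.sqrt_pos.2 (hpos hx)
  have hm0 : 0 < m := Real.sqrt_pos.2 (hpos hy)
  have hn2 : n ^ 2 = x ⬝ᵥ x := Real.sq_sqrt (hpos hx).le
  have hm2 : m ^ 2 = y ⬝ᵥ y := Real.sq_sqrt (hpos hy).le
  have hcs : |x ⬝ᵥ y| ≤ n * m := by
    refine abs_le_of_sq_le_sq ?_ (by positivity)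
    rw [mul_pow, hn2, hm2]
    simpa only [dotProduct, sq] using Finset.sum_mul_sq_le_sq_mul_sq Finset.univ x y
  set θ := Real.arccos ((x ⬝ᵥ y) / (n * m)) with hθ
  have hθ_mem : θ ∈ Set.Icc 0 π := ⟨arccos_nonneg _, arccos_le_pi _⟩
  have hcos : cos θ * (n * m) = x ⬝ᵥ y := by
    have h : |(x ⬝ᵥ y) / (n * m)| ≤ 1 := by
      rw [abs_div, abs_of_pos (mul_pos hn0 hm0)]
      exact div_le_one_of_le₀ hcs (by positivity)
    rw [hθ, Real.cos_arccos (neg_le_of_abs_le h) (le_of_abs_le h),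
      div_mul_cancel₀ _ (by positivity)]
  let ℓ (z : Fin d → ℝ) : (Fin d → ℝ) →L[ℝ] ℝ := ∑ i, z i • ContinuousLinearMap.proj i
  let T : (Fin d → ℝ) →L[ℝ] ℝ × ℝ := (ℓ x).prod (ℓ y)
  have hT (w : Fin d → ℝ) : T w = (w ⬝ᵥ x, w ⬝ᵥ y) := by
    simp [T, ℓ, dotProduct, mul_comm]
  let S : ℝ × ℝ →L[ℝ] ℝ × ℝ :=
    (n • ContinuousLinearMap.fst ℝ ℝ ℝ).prod
      ((m * cos θ) • ContinuousLinearMap.fst ℝ ℝ ℝ + (m * sin θ) • ContinuousLinearMap.snd ℝ ℝ ℝ)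
  have hS (p : ℝ × ℝ) : S p = (n * p.1, m * cos θ * p.1 + m * sin θ * p.2) := by simp [S]
  have hmap := map_pi_gaussianReal_eq_map_prod T hT S hS hn2.symm
    (by linear_combination -hcos) (by linear_combination -hm2 - m ^ 2 * sin_sq_add_cos_sq θ)
  have hQ : MeasurableSet (Set.Ioi (0 : ℝ) ×ˢ Set.Ioi (0 : ℝ)) := measurableSet_Ioi.prod measurableSet_Ioi
  have hset : {w : Fin d → ℝ | 0 < w ⬝ᵥ x ∧ 0 < w ⬝ᵥ y} = T ⁻¹' (Set.Ioi 0 ×ˢ Set.Ioi 0) := by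
    ext w
    simp [hT]
  rw [stdGaussian_eq_pi, hset, ← Measure.map_apply T.measurable hQ, hmap,
    Measure.map_apply S.measurable hQ,
    gaussianReal_prod_apply_eq_div (A := Set.Ioo (θ - π / 2) (π / 2)) (S.measurable hQ)
      measurableSet_Ioo, Set.inter_eq_left.2, Real.volume_Ioo, ← ENNReal.ofReal_div_of_pos (by positivity)]
  · congr 2
    ring
  · exact Set.Ioo_subset_Ioo (by linarith [hθ_mem.1, pi_pos]) (by linarith [pi_pos])
  · intro r φ hr hφ
    rw [← cos_pos_and_cos_sub_pos_iff hθ_mem hφ, Set.mem_preimage, hS, Set.mem_prod, Set.mem_Ioi, Set.mem_Ioi,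
      cos_sub,
      show m * cos θ * (r * cos φ) + m * sin θ * (r * sin φ) =
        (m * r) * (cos φ * cos θ + sin φ * sin θ) by ring, ← mul_assoc,
      mul_pos_iff_of_pos_left (mul_pos hn0 hr), mul_pos_iff_of_pos_left (mul_pos hm0 hr)]
end

section
/- Let X be a nonempty set and let K̃ : X × X → ℝ be a symmetric positive semidefinite kernel with K̃(x,x) > 0 for all x ∈ X. Define K : X × X → ℝ by K(x,y) = (1/(2π)) √(K̃(x,x) K̃(y,y)) ( sin θ(x,y) + (π − θ(x,y)) cos θ(x,y) ), where θ(x,y) = arccos( K̃(x,y) / √(K̃(x,x) K̃(y,y)) ). Then K is a symmetric positive semidefinite kernel on X, i.e., for all N, all x₁,…,x_N ∈ X and all c ∈ ℝ^N, ∑_{i,j} c_i c_j K(x_i,x_j) ≥ 0. (Composition of the degree-1 arc-cosine kernel with an arbitrary base kernel, as used in deep-wide learning.) -/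
open Real Finset

/-- The degree-1 arc-cosine kernel composed with a base kernel `Kt`:
`K(x,y) = (1/(2π)) √(Kt(x,x) Kt(y,y)) (sin θ + (π - θ) cos θ)` with
`θ = arccos(Kt(x,y)/√(Kt(x,x) Kt(y,y)))`. -/
noncomputable def arcCompose {X : Type*} (Kt : X → X → ℝ) (x y : X) : ℝ :=
  (1 / (2 * π)) * Real.sqrt (Kt x x * Kt y y) *
    (Real.sin (Real.arccos (Kt x y / Real.sqrt (Kt x x * Kt y y))) +
      (π - Real.arccos (Kt x y / Real.sqrt (Kt x x * Kt y y))) *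
        Real.cos (Real.arccos (Kt x y / Real.sqrt (Kt x x * Kt y y))))

lemma Matrix.posSemidef_of_sum_nonneg {ι : Type*} [Fintype ι] {A : Matrix ι ι ℝ}
    (hsymm : ∀ i j, A i j = A j i) (hA : ∀ c : ι → ℝ, 0 ≤ ∑ i, ∑ j, c i * c j * A i j) :
    A.PosSemidef := by
  refine .of_dotProduct_mulVec_nonneg (Matrix.ext fun i j => by simp [hsymm i j]) fun c => ?_
  simpa [dotProduct, Matrix.mulVec, Finset.mul_sum, mul_assoc, mul_comm, mul_left_comm] using hA c

lemma Matrix.PosSemidef.sum_nonneg {ι : Type*} [Fintype ι] {A : Matrix ι ι ℝ}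
    (hA : A.PosSemidef) (c : ι → ℝ) : 0 ≤ ∑ i, ∑ j, c i * c j * A i j := by
  simpa [dotProduct, Matrix.mulVec, Finset.mul_sum, mul_assoc, mul_comm, mul_left_comm]
    using hA.dotProduct_mulVec_nonneg c

lemma Matrix.PosSemidef.map_pow {ι : Type*} [Fintype ι] {A : Matrix ι ι ℝ}
    (hA : A.PosSemidef) (n : ℕ) : (A.map (· ^ n)).PosSemidef := by
  induction n with
  | zero =>
    convert! Matrix.posSemidef_vecMulVec_self_star (fun _ : ι => (1 : ℝ)) using 1
    ext i j
    simp [Matrix.vecMulVec_apply]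
  | succ n ih =>
    have h : A.map (· ^ (n + 1)) = (A.map (· ^ n)).hadamard A := by
      ext i j
      simp [pow_succ]
    exact h ▸ ih.hadamard hA

/-- Entrywise application of a convergent power series with nonnegative coefficients preserves
positive semidefiniteness. -/
lemma Matrix.PosSemidef.map_of_hasSum {ι : Type*} [Fintype ι] {A : Matrix ι ι ℝ}
    (hA : A.PosSemidef) {a : ℕ → ℝ} (ha : ∀ n, 0 ≤ a n) {f : ℝ → ℝ}
    (hf : ∀ i j, HasSum (fun n => a n * A i j ^ n) (f (A i j))) : (A.map f).PosSemidef := by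
  have hs : ∀ i j, A i j = A j i := fun i j => by simpa using hA.1.apply j i
  refine Matrix.posSemidef_of_sum_nonneg (fun i j => by simp [hs i j]) fun c => ?_
  have h : HasSum (fun n => ∑ i, ∑ j, c i * c j * (a n * A i j ^ n))
      (∑ i, ∑ j, c i * c j * f (A i j)) :=
    hasSum_sum fun i _ => hasSum_sum fun j _ => (hf i j).mul_left _
  refine h.nonneg fun n => ?_
  refine (mul_nonneg (ha n) ((hA.map_pow n).sum_nonneg c)).trans_eq ?_
  simp only [Finset.mul_sum, Matrix.map_apply]
  exact Finset.sum_congr rfl fun i _ => Finset.sum_congr rfl fun j _ => by ring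

lemma Ring.choose_half_add_sub_one_nonneg (n : ℕ) : 0 ≤ Ring.choose ((1 / 2 : ℝ) + n - 1) n := by
  rw [Ring.choose_eq_smul, Polynomial.descPochhammer_smeval_eq_ascPochhammer,
    show (1 / 2 : ℝ) + n - 1 - n + 1 = 1 / 2 by ring, Polynomial.ascPochhammer_smeval_cast,
    Polynomial.ascPochhammer_smeval_eq_eval]
  exact smul_nonneg (by positivity) (ascPochhammer_pos n _ (by norm_num)).le

lemma hasSum_one_div_sqrt_one_sub {x : ℝ} (hx : |x| < 1) :
    HasSum (fun n : ℕ => Ring.choose ((1 / 2 : ℝ) + n - 1) n * x ^ n) (1 / √(1 - x)) := by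
  have h := (Real.one_div_one_sub_rpow_hasFPowerSeriesOnBall_zero (1 / 2)).hasSum (y := x)
    (by simpa [enorm_eq_nnnorm, ← NNReal.coe_lt_coe] using hx)
  simpa [Real.sqrt_eq_rpow, FormalMultilinearSeries.ofScalars_apply_eq, mul_comm] using h

lemma hasDerivAt_pi_sub_arccos {x : ℝ} (hx : |x| < 1) :
    HasDerivAt (fun t => π - arccos t) (1 / √(1 - x ^ 2)) x := by
  obtain ⟨h1, h2⟩ := abs_lt.1 hx
  simpa using (hasDerivAt_arccos h1.ne' h2.ne).const_sub π

lemma hasDerivAt_sqrt_add_mul_pi_sub_arccos {x : ℝ} (hx : |x| < 1) :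
    HasDerivAt (fun t => √(1 - t ^ 2) + (π - arccos t) * t) (π - arccos x) x := by
  have hpos : 0 < 1 - x ^ 2 := by
    have := (sq_lt_one_iff_abs_lt_one x).2 hx
    linarith
  have h := (((hasDerivAt_pow 2 x).const_sub 1).sqrt hpos.ne').add
    ((hasDerivAt_pi_sub_arccos hx).mul (hasDerivAt_id x))
  convert! h using 1
  have := (Real.sqrt_pos.2 hpos).ne'
  simp only [id]
  field_simp
  ring

lemma Matrix.PosSemidef.map_one_div_sqrt_one_sub_sq {ι : Type*} [Fintype ι] {A : Matrix ι ι ℝ}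
    (hA : A.PosSemidef) (hA1 : ∀ i j, |A i j| < 1) :
    (A.map fun t => 1 / √(1 - t ^ 2)).PosSemidef :=
  (hA.map_pow 2).map_of_hasSum (f := fun t => 1 / √(1 - t))
    Ring.choose_half_add_sub_one_nonneg fun i j => hasSum_one_div_sqrt_one_sub <| by
      simpa [abs_pow] using hA1 i j

/-- The degree-1 arc-cosine function applied entrywise to a correlation matrix has a nonnegative
quadratic form. -/
lemma Matrix.PosSemidef.sum_arccos_nonneg {ι : Type*} [Fintype ι] {T : Matrix ι ι ℝ}
    (hT : T.PosSemidef) (hT1 : ∀ i j, |T i j| ≤ 1) (c : ι → ℝ) :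
    0 ≤ ∑ i, ∑ j, c i * c j * (√(1 - T i j ^ 2) + (π - arccos (T i j)) * T i j) := by
  set G : ℝ → ℝ := fun s => ∑ i, ∑ j, c i * c j *
    (√(1 - (s * T i j) ^ 2) + (π - arccos (s * T i j)) * (s * T i j)) with hG
  set H : ℝ → ℝ := fun s => ∑ i, ∑ j, c i * c j * ((π - arccos (s * T i j)) * T i j) with hH
  have hlt : ∀ s ∈ Set.Ioo (0 : ℝ) 1, ∀ i j, |s * T i j| < 1 := fun s hs i j => by
    rw [abs_mul, abs_of_pos hs.1]
    nlinarith [hT1 i j, hs.1, hs.2, abs_nonneg (T i j)]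
  have hd : ∀ s i j, HasDerivAt (fun s => s * T i j) (T i j) s := fun s i j => by
    simpa using (hasDerivAt_id s).mul_const (T i j)
  have hGd : ∀ s ∈ Set.Ioo (0 : ℝ) 1, HasDerivAt G (H s) s := fun s hs =>
    HasDerivAt.fun_sum fun i _ => HasDerivAt.fun_sum fun j _ =>
      ((hasDerivAt_sqrt_add_mul_pi_sub_arccos (hlt s hs i j)).comp s (hd s i j)).const_mul _
  have hHd : ∀ s ∈ Set.Ioo (0 : ℝ) 1, HasDerivAt H
      (∑ i, ∑ j, c i * c j * (1 / √(1 - (s * T i j) ^ 2) * T i j * T i j)) s := fun s hs =>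
    HasDerivAt.fun_sum fun i _ => HasDerivAt.fun_sum fun j _ =>
      (((hasDerivAt_pi_sub_arccos (hlt s hs i j)).comp s (hd s i j)).mul_const _).const_mul _
  have hGc : Continuous G := by fun_prop
  have hHc : Continuous H := by fun_prop
  have hHmono : MonotoneOn H (Set.Icc 0 1) := by
    refine monotoneOn_of_deriv_nonneg (convex_Icc 0 1) hHc.continuousOn ?_ ?_ <;>
      rw [interior_Icc] <;> intro s hs
    · exact (hHd s hs).differentiableAt.differentiableWithinAt
    · rw [(hHd s hs).deriv]
      exact ((((hT.smul hs.1.le).map_one_div_sqrt_one_sub_sq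
        (by simpa using hlt s hs)).hadamard hT).hadamard hT).sum_nonneg c
  have hH0 : 0 ≤ H 0 := by
    refine (mul_nonneg (half_pos pi_pos).le (hT.sum_nonneg c)).trans_eq ?_
    simp only [hH, Finset.mul_sum, zero_mul, arccos_zero]
    exact Finset.sum_congr rfl fun i _ => Finset.sum_congr rfl fun j _ => by ring
  have hGmono : MonotoneOn G (Set.Icc 0 1) := by
    refine monotoneOn_of_deriv_nonneg (convex_Icc 0 1) hGc.continuousOn ?_ ?_ <;>
      rw [interior_Icc] <;> intro s hs
    · exact (hGd s hs).differentiableAt.differentiableWithinAt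
    · rw [(hGd s hs).deriv]
      exact hH0.trans (hHmono (by simp) (Set.Ioo_subset_Icc_self hs) hs.1.le)
  have hG0 : 0 ≤ G 0 := by
    have : G 0 = (∑ i, c i) * ∑ j, c j := by simp [hG, Finset.sum_mul_sum]
    exact this ▸ mul_self_nonneg _
  simpa [hG] using hG0.trans (hGmono (by simp) (by simp) zero_le_one)

lemma abs_le_sqrt_mul_of_psd {X : Type*} {Kt : X → X → ℝ}
    (hsymm : ∀ x y, Kt x y = Kt y x)
    (hpsd : ∀ (N : ℕ) (x : Fin N → X) (c : Fin N → ℝ),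
      0 ≤ ∑ i, ∑ j, c i * c j * Kt (x i) (x j))
    (hpos : ∀ x, 0 < Kt x x) (x y : X) : |Kt x y| ≤ √(Kt x x) * √(Kt y y) := by
  have ha := Real.sqrt_pos.2 (hpos x)
  have hb := Real.sqrt_pos.2 (hpos y)
  have ha2 := Real.sq_sqrt (hpos x).le
  have hb2 := Real.sq_sqrt (hpos y).le
  have h1 := hpsd 2 ![x, y] ![√(Kt y y), √(Kt x x)]
  have h2 := hpsd 2 ![x, y] ![√(Kt y y), -√(Kt x x)]
  simp only [Fin.sum_univ_two, Matrix.cons_val_zero, Matrix.cons_val_one, hsymm y x] at h1 h2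
  generalize √(Kt x x) = a at *
  generalize √(Kt y y) = b at *
  rw [← ha2, ← hb2] at h1 h2
  have hab := mul_pos ha hb
  exact abs_le.2 ⟨by nlinarith, by nlinarith⟩

/-- **Composition of the degree-1 arc-cosine kernel with a base kernel.** If `Kt` is a
symmetric positive semidefinite kernel on a nonempty set `X` with `Kt(x,x) > 0` for all
`x`, then the composed kernel `K` is again symmetric positive semidefinite. -/
theorem statement12 {X : Type*} [Nonempty X] (Kt : X → X → ℝ)
    (hsymm : ∀ x y, Kt x y = Kt y x)
    (hpsd : ∀ (N : ℕ) (x : Fin N → X) (c : Fin N → ℝ),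
      0 ≤ ∑ i, ∑ j, c i * c j * Kt (x i) (x j))
    (hpos : ∀ x, 0 < Kt x x) :
    (∀ x y, arcCompose Kt x y = arcCompose Kt y x) ∧
    (∀ (N : ℕ) (x : Fin N → X) (c : Fin N → ℝ),
      0 ≤ ∑ i, ∑ j, c i * c j * arcCompose Kt (x i) (x j)) := by
  refine ⟨fun x y => by simp only [arcCompose, hsymm x y, mul_comm (Kt x x)], fun N x c => ?_⟩
  let T : Matrix (Fin N) (Fin N) ℝ :=
    .of fun i j => Kt (x i) (x j) / √(Kt (x i) (x i) * Kt (x j) (x j))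
  have hsqrt : ∀ i j, √(Kt (x i) (x i) * Kt (x j) (x j)) =
      √(Kt (x i) (x i)) * √(Kt (x j) (x j)) := fun i j => Real.sqrt_mul (hpos _).le _
  have hT1 : ∀ i j, |T i j| ≤ 1 := fun i j => by
    have hp : 0 < √(Kt (x i) (x i) * Kt (x j) (x j)) :=
      Real.sqrt_pos.2 (mul_pos (hpos _) (hpos _))
    simp only [T, Matrix.of_apply, abs_div, abs_of_pos hp]
    rw [div_le_one hp, hsqrt]
    exact abs_le_sqrt_mul_of_psd hsymm hpsd hpos _ _
  have hT : T.PosSemidef := by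
    refine Matrix.posSemidef_of_sum_nonneg
      (fun i j => by simp only [T, Matrix.of_apply, hsymm (x i) (x j), mul_comm]) fun d => ?_
    refine (hpsd N x fun i => d i / √(Kt (x i) (x i))).trans_eq
      (Finset.sum_congr rfl fun i _ => Finset.sum_congr rfl fun j _ => ?_)
    simp only [T, Matrix.of_apply, hsqrt]
    ring
  refine (mul_nonneg (by positivity : 0 ≤ 1 / (2 * π))
    (hT.sum_arccos_nonneg hT1 fun i => c i * √(Kt (x i) (x i)))).trans_eq ?_
  simp only [Finset.mul_sum]
  refine Finset.sum_congr rfl fun i _ => Finset.sum_congr rfl fun j _ => ?_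
  have hc : cos (arccos (T i j)) = T i j :=
    cos_arccos (abs_le.1 (hT1 i j)).1 (abs_le.1 (hT1 i j)).2
  have hK : arcCompose Kt (x i) (x j) = (1 / (2 * π)) * √(Kt (x i) (x i) * Kt (x j) (x j)) *
      (sin (arccos (T i j)) + (π - arccos (T i j)) * cos (arccos (T i j))) := rfl
  rw [hK, hc, sin_arccos, hsqrt]
  ring
end
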